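/- For every real number λ, Σ_{k∈ℤ} sinc(λ − k)² = 1, and likewise ∫_ℝ sinc(λ − t)² dt = 1. -/

import Mathlib

open MeasureTheory

/-- The normalized sinc function: `sinc x = sin (π x) / (π x)` for `x ≠ 0`, `sinc 0 = 1`. -/
noncomputable def sincFun (x : ℝ) : ℝ :=
  if x = 0 then 1 else Real.sin (Real.pi * x) / (Real.pi * x)

/-- `sinc` is the Fourier transform of the indicator function of `[-1/2, 1/2]`. -/
lemma intervalIntegral_exp_eq_sincFun (x : ℝ) :
    ∫ t in (-(1 / 2) : ℝ)..(1 / 2), Complex.exp (2 * Real.pi * Complex.I * x * t) =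
      (sincFun x : ℂ) := by
  by_cases hx : x = 0
  · simp only [hx, sincFun]; norm_num
  · have hxc : (x : ℂ) ≠ 0 := by exact_mod_cast hx
    have hπ : (Real.pi : ℂ) ≠ 0 := by exact_mod_cast Real.pi_ne_zero
    have hc : 2 * Real.pi * Complex.I * x ≠ 0 := by simp [hx, Real.pi_ne_zero]
    rw [integral_exp_mul_complex hc, sincFun, if_neg hx]
    push_cast
    rw [Complex.sin]
    have e1 : 2 * Real.pi * Complex.I * x * (1 / 2 : ℂ) = Real.pi * x * Complex.I := by ring
    have e2 : 2 * Real.pi * Complex.I * x * (-(1 / 2) : ℂ) = -(Real.pi * x) * Complex.I := by ring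
    rw [e1, e2]
    field_simp
    rw [Complex.I_sq]
    ring

lemma fourierCoeffOn_exp (lam : ℝ) (k : ℤ) :
    fourierCoeffOn (a := -(1 / 2)) (b := 1 / 2) (by norm_num : (-(1 / 2) : ℝ) < 1 / 2)
      (fun t : ℝ ↦ Complex.exp (2 * Real.pi * Complex.I * lam * t)) k =
        (sincFun (lam - k) : ℂ) := by
  rw [fourierCoeffOn_eq_integral, ← intervalIntegral_exp_eq_sincFun]
  norm_num
  refine intervalIntegral.integral_congr fun t _ ↦ ?_
  simp only [← Complex.exp_add, ← Complex.exp_conj]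
  congr 1
  simp only [map_mul, Complex.conj_I, Complex.conj_ofReal, map_ofNat, map_intCast]
  ring

lemma hasSum_sincFun_sq (lam : ℝ) : HasSum (fun k : ℤ ↦ sincFun (lam - k) ^ 2) 1 := by
  have hnorm (t : ℝ) : ‖Complex.exp (2 * Real.pi * Complex.I * lam * t)‖ = 1 := by
    rw [show 2 * Real.pi * Complex.I * lam * t = ((2 * Real.pi * lam * t : ℝ) : ℂ) * Complex.I by
      push_cast; ring, Complex.norm_exp_ofReal_mul_I]
  have hL2 : MemLp (fun t : ℝ ↦ Complex.exp (2 * Real.pi * Complex.I * lam * t)) 2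
      (volume.restrict (Set.Ioc (-(1 / 2)) (1 / 2))) :=
    MemLp.of_bound (by fun_prop) 1 (.of_forall fun t ↦ (hnorm t).le)
  have h := hasSum_sq_fourierCoeffOn (by norm_num : (-(1 / 2) : ℝ) < 1 / 2) hL2
  simp only [fourierCoeffOn_exp, hnorm, Complex.norm_real, Real.norm_eq_abs, sq_abs] at h
  norm_num at h
  exact h

lemma measurable_sincFun : Measurable sincFun :=
  Measurable.ite (measurableSet_singleton 0) measurable_const (by fun_prop)

lemma lintegral_eq_setLIntegral_tsum_sub_intCast {f : ℝ → ENNReal} (hf : Measurable f) :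
    ∫⁻ t, f t = ∫⁻ t in Set.Ioc 0 1, ∑' k : ℤ, f (t - k) := by
  rw [← setLIntegral_univ, ← iUnion_Ioc_intCast,
    lintegral_iUnion (fun _ ↦ measurableSet_Ioc) (Set.pairwise_disjoint_Ioc_intCast ℝ),
    lintegral_tsum (fun k ↦ by fun_prop), ← (Equiv.neg ℤ).tsum_eq]
  refine tsum_congr fun k ↦ ?_
  rw [← (measurePreserving_sub_right volume (k : ℝ)).setLIntegral_comp_preimage
    measurableSet_Ioc hf]
  simp [add_comm]

lemma integral_sincFun_sq : ∫ t : ℝ, sincFun t ^ 2 = 1 := by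
  have hm := measurable_sincFun
  rw [integral_eq_lintegral_of_nonneg_ae (.of_forall fun t ↦ sq_nonneg _)
    (by fun_prop), lintegral_eq_setLIntegral_tsum_sub_intCast (by fun_prop)]
  have h (t : ℝ) : ∑' k : ℤ, ENNReal.ofReal (sincFun (t - k) ^ 2) = 1 := by
    rw [← ENNReal.ofReal_tsum_of_nonneg (fun _ ↦ sq_nonneg _) (hasSum_sincFun_sq t).summable,
      (hasSum_sincFun_sq t).tsum_eq, ENNReal.ofReal_one]
  simp [h]

/-- For every real `λ`, `Σ_{k∈ℤ} sinc(λ - k)² = 1` and `∫_ℝ sinc(λ - t)² dt = 1`. -/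
theorem sinc_sq_sum_and_integral (lam : ℝ) :
    (∑' k : ℤ, sincFun (lam - k) ^ 2 = 1) ∧
    (∫ t : ℝ, sincFun (lam - t) ^ 2 = 1) :=
  ⟨(hasSum_sincFun_sq lam).tsum_eq, by
    rw [integral_sub_left_eq_self (fun t ↦ sincFun t ^ 2) volume lam, integral_sincFun_sq]⟩
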